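/- arXiv:1904.07763 — 2 statements merged into one kernel-verified Lean document; each statement's English description precedes it below -/
import Mathlib

section
/- For every odd positive integer p there exists N ∈ ℕ such that for all n ≥ N the eigenvalues λ_k(n) = −(1/2)·Σ_{j=0}^{n−1} D_{0j}² ω_n^{jk} of the double-centered matrix B of n evenly spaced points on the geodesic circle satisfy λ_1(n) ≥ λ_3(n) ≥ λ_5(n) ≥ ⋯ ≥ λ_p(n) ≥ 0 (the inequalities ranging over odd indices 1, 3, …, p). -/
/-- Geodesic distance `D_{0j}` from the `0`-th to the `j`-th of `n` evenly spaced
points on the circle of circumference `2π`: `(2π/n)·min(j, n−j)`. -/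
noncomputable def circDist0 (n j : ℕ) : ℝ :=
  (2 * Real.pi / n) * ((min j (n - j) : ℕ) : ℝ)

/-- `λ_k(n) = -(1/2) ∑_{j=0}^{n-1} D_{0j}^2 ω_n^{jk}`, with `ω_n = e^{2πi/n}`. -/
noncomputable def circEig (n k : ℕ) : ℂ :=
  -(1/2) * ∑ j ∈ Finset.range n, ((circDist0 n j ^ 2 : ℝ) : ℂ) *
    Complex.exp (2 * Real.pi * Complex.I / n) ^ (j * k)

open Real in
/-- Closed form of the trapezoidal sum of `j² cos (2jy)`. -/
theorem sin_pow_three_mul_sum_sq_mul_cos (y : ℝ) (m : ℕ) :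
    sin y ^ 3 * ∑ j ∈ Finset.range m, ((j : ℝ) ^ 2 * cos (2 * j * y) +
      ((j : ℝ) + 1) ^ 2 * cos (2 * (j + 1) * y)) =
    m ^ 2 * sin (2 * m * y) * cos y * sin y ^ 2 + m * cos (2 * m * y) * sin y -
      cos y * sin (2 * m * y) / 2 := by
  induction m with
  | zero => simp
  | succ m ih =>
    rw [Finset.sum_range_succ, mul_add, ih]
    push_cast
    have h : 2 * ((m : ℝ) + 1) * y = 2 * m * y + 2 * y := by ring
    rw [h, cos_add, sin_add, cos_two_mul, sin_two_mul]
    generalize cos (2 * m * y) = C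
    generalize sin (2 * m * y) = S
    have hs : cos y ^ 2 = 1 - sin y ^ 2 := cos_sq' y
    generalize cos y = c at *
    generalize sin y = s at *
    grind

open Real in
theorem circEig_re (n k : ℕ) :
    (circEig n k).re = -(1 / 2) * (2 * π / n) ^ 2 * ∑ j ∈ Finset.range n,
      ((min j (n - j) : ℕ) : ℝ) ^ 2 * cos (2 * j * (π * k / n)) := by
  have h (j : ℕ) : Complex.exp (2 * π * Complex.I / n) ^ (j * k) =
      Complex.exp ((2 * j * (π * k / n) : ℝ) * Complex.I) := by
    rw [← Complex.exp_nat_mul]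
    push_cast
    ring_nf
  have hc : (-(1 / 2) : ℂ) = ((-(1 / 2) : ℝ) : ℂ) := by push_cast; rfl
  unfold circEig
  rw [hc, Complex.re_ofReal_mul, Complex.re_sum, mul_assoc (-(1 / 2) : ℝ)]
  congr 1
  rw [Finset.mul_sum]
  refine Finset.sum_congr rfl fun j _ => ?_
  rw [Complex.re_ofReal_mul, h, Complex.exp_ofReal_mul_I_re, circDist0]
  ring

open Real in
theorem sum_min_sq_mul_cos {n k a b : ℕ} (hn : n = a + b) (hab : b ≤ a) (hba : a ≤ b + 1)
    (hb : 0 < b) :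
    ∑ j ∈ Finset.range n, ((min j (n - j) : ℕ) : ℝ) ^ 2 * cos (2 * j * (π * k / n)) =
    ∑ j ∈ Finset.range a, (j : ℝ) ^ 2 * cos (2 * j * (π * k / n)) +
    ∑ j ∈ Finset.range b, ((j : ℝ) + 1) ^ 2 * cos (2 * (j + 1) * (π * k / n)) := by
  have hn0 : (n : ℝ) ≠ 0 := by
    have : n ≠ 0 := by omega
    exact_mod_cast this
  conv_lhs => rw [show Finset.range n = Finset.range (a + b) by rw [hn]]
  rw [Finset.sum_range_add]
  congr 1
  · refine Finset.sum_congr rfl fun j hj => ?_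
    rw [Finset.mem_range] at hj
    rw [min_eq_left (by omega)]
  · rw [← Finset.sum_range_reflect]
    refine Finset.sum_congr rfl fun j hj => ?_
    rw [Finset.mem_range] at hj
    have h1 : a + (b - 1 - j) = n - (j + 1) := by omega
    have h2 : min (n - (j + 1)) (n - (n - (j + 1))) = j + 1 := by omega
    rw [h1, h2, Nat.cast_sub (by omega)]
    push_cast
    congr 1
    rw [← cos_nat_mul_two_pi_sub _ k]
    congr 1
    field_simp
    ring

open Real in
theorem sin_mul_pi_add_of_odd {k : ℕ} (hk : Odd k) (y : ℝ) :
    sin (π * k - y) = sin y ∧ cos (π * k - y) = -cos y := by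
  obtain ⟨t, rfl⟩ := hk
  have : π * ((2 * t + 1 : ℕ) : ℝ) - y = (π - y) + t * (2 * π) := by push_cast; ring
  rw [this, sin_add_nat_mul_two_pi, cos_add_nat_mul_two_pi, sin_pi_sub, cos_pi_sub]
  exact ⟨rfl, rfl⟩

open Real in
/-- Closed form of the odd-index eigenvalues. -/
theorem circEig_re_of_odd {n k : ℕ} (hk : Odd k) (hkn : k < n) :
    (circEig n k).re = π ^ 2 / n *
      ((if Even n then 1 else cos (π * k / n)) / sin (π * k / n) ^ 2) := by
  have hk0 : 0 < k := hk.pos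
  have hn : (0 : ℝ) < n := by exact_mod_cast (by omega : 0 < n)
  have hs : 0 < sin (π * k / n) := by
    apply sin_pos_of_pos_of_lt_pi
    · positivity
    · rw [div_lt_iff₀ hn]
      exact mul_lt_mul_of_pos_left (by exact_mod_cast hkn) pi_pos
  rw [circEig_re]
  split_ifs with he
  · obtain ⟨m, hm⟩ := he
    rw [sum_min_sq_mul_cos hm le_rfl (by omega) (by omega), ← Finset.sum_add_distrib]
    have key := sin_pow_three_mul_sum_sq_mul_cos (π * k / n) m
    have hθ : 2 * (m : ℝ) * (π * k / n) = π * k - 0 := by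
      have : (n : ℝ) = 2 * m := by rw [hm]; push_cast; ring
      rw [← this]; field_simp; ring
    obtain ⟨h1, h2⟩ := sin_mul_pi_add_of_odd hk 0
    rw [hθ, h1, h2, sin_zero, cos_zero] at key
    have hnm : (m : ℝ) = n / 2 := by rw [hm]; push_cast; ring
    rw [hnm] at key
    generalize ∑ j ∈ Finset.range m, (_ : ℝ) = T at *
    generalize sin (π * k / n) = s at *
    have : T = -(n / 2) / s ^ 2 := by
      rw [eq_div_iff (by positivity)]
      apply mul_left_cancel₀ hs.ne'
      linear_combination key
    rw [this]
    field_simp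
  · obtain ⟨m, hm⟩ := Nat.not_even_iff_odd.mp he
    rw [sum_min_sq_mul_cos (a := m + 1) (b := m) (by omega) (by omega) (by omega) (by omega),
      Finset.sum_range_succ, add_right_comm, ← Finset.sum_add_distrib]
    have key := sin_pow_three_mul_sum_sq_mul_cos (π * k / n) m
    have hnm : (m : ℝ) = (n - 1) / 2 := by rw [hm]; push_cast; ring
    have hθ : 2 * (m : ℝ) * (π * k / n) = π * k - π * k / n := by
      rw [hnm]; field_simp
    obtain ⟨h1, h2⟩ := sin_mul_pi_add_of_odd hk (π * k / n)
    rw [hθ, h1, h2] at key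
    rw [hθ, h2]
    generalize ∑ j ∈ Finset.range m, (_ : ℝ) = T at *
    rw [hnm] at *
    generalize sin (π * k / n) = s at *
    generalize cos (π * k / n) = c at *
    have : T + ((n - 1) / 2) ^ 2 * -c = -(n / 2) * c / s ^ 2 := by
      rw [eq_div_iff (by positivity)]
      apply mul_left_cancel₀ hs.ne'
      linear_combination key
    rw [this]
    field_simp

theorem statement10 (p : ℕ) (hpodd : Odd p) (hppos : 0 < p) :
    ∃ N : ℕ, ∀ n : ℕ, N ≤ n →
      (∀ k₁ k₂ : ℕ, Odd k₁ → Odd k₂ → k₁ ≤ k₂ → k₂ ≤ p →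
        (circEig n k₂).re ≤ (circEig n k₁).re) ∧
      0 ≤ (circEig n p).re := by
  refine ⟨2 * p, fun n hn => ?_⟩
  have hn0 : (0 : ℝ) < n := by exact_mod_cast (by omega : 0 < n)
  have hπ := Real.pi_pos
  have hle (k : ℕ) (hk : k ≤ p) : Real.pi * k / n ≤ Real.pi / 2 := by
    have : (2 * k : ℝ) ≤ n := by exact_mod_cast (by omega : 2 * k ≤ n)
    rw [div_le_div_iff₀ hn0 two_pos]
    nlinarith
  have hnum (k : ℕ) (hk : k ≤ p) :
      0 ≤ (if Even n then 1 else Real.cos (Real.pi * k / n)) := by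
    split_ifs
    · exact zero_le_one
    · refine Real.cos_nonneg_of_neg_pi_div_two_le_of_le ?_ (hle k hk)
      have : 0 ≤ Real.pi * k / n := by positivity
      linarith
  constructor
  · intro k₁ k₂ h₁ h₂ h₁₂ h₂p
    have hpos : 0 < Real.pi * k₁ / n := by
      have : (0 : ℝ) < k₁ := by exact_mod_cast h₁.pos
      positivity
    have hmono : Real.pi * k₁ / n ≤ Real.pi * k₂ / n := by gcongr
    have h2 := hle k₂ h₂p
    have hs : 0 < Real.sin (Real.pi * k₁ / n) :=
      Real.sin_pos_of_pos_of_lt_pi hpos (by linarith)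
    have hss : Real.sin (Real.pi * k₁ / n) ≤ Real.sin (Real.pi * k₂ / n) :=
      Real.sin_le_sin_of_le_of_le_pi_div_two (by linarith) h2 hmono
    rw [circEig_re_of_odd h₁ (by omega), circEig_re_of_odd h₂ (by omega)]
    refine mul_le_mul_of_nonneg_left ?_ (by positivity)
    refine div_le_div₀ (hnum k₁ (h₁₂.trans h₂p)) ?_ (by positivity) (by gcongr)
    split_ifs
    · exact le_rfl
    · exact Real.cos_le_cos_of_nonneg_of_le_pi hpos.le (by linarith) hmono
  · rw [circEig_re_of_odd hpodd (by omega)]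
    exact mul_nonneg (by positivity) (div_nonneg (hnum p le_rfl) (sq_nonneg _))
end

section
/- Let (X,d) be a bounded metric space, let x_1, x_2, … ∈ X, and suppose the empirical measures μ_n = (1/n)Σ_{i=1}^n δ_{x_i} converge to a Borel probability measure μ in total variation. Let K_n and K be the associated kernels of (X,d,μ_n) and (X,d,μ), which are uniformly bounded and satisfy ‖K_n − K‖_∞ → 0. Fix k, and suppose λ_{k,n} → λ_k with λ_k ≠ 0, where λ_{k,n}·φ_{k,n}(x) = ∫_X K_n(x,y)φ_{k,n}(y) dμ_n(y) for all x ∈ X, and suppose the eigenfunctions φ_{k,n} converge uniformly on X to a function φ_{k,∞}, with ∫|φ_{k,n}| dμ_n uniformly bounded. Then φ_{k,∞} is an eigenfunction of the limiting operator with eigenvalue λ_k: λ_k·φ_{k,∞}(x) = ∫_X K(x,y)φ_{k,∞}(y) dμ(y) for all x ∈ X. -/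
open MeasureTheory Filter
open scoped ENNReal

/-- The kernel associated to a bounded metric measure space `(X, d, ν)`:
`K_ν(x,y) = (1/2)(−d(x,y)² + ∫ d(w,y)² dν(w) + ∫ d(x,z)² dν(z) − ∫∫ d(w,z)² d(ν⊗ν))`. -/
noncomputable def assocKernel {X : Type*} [MetricSpace X] [MeasurableSpace X]
    (ν : Measure X) (x y : X) : ℝ :=
  (1/2) * (-(dist x y ^ 2) + (∫ w, dist w y ^ 2 ∂ν) + (∫ z, dist x z ^ 2 ∂ν)
    - ∫ p : X × X, dist p.1 p.2 ^ 2 ∂(ν.prod ν))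

/-- The empirical measure `(1/n) ∑_{i<n} δ_{x_i}` integrates every function to its average. -/
theorem integral_empirical {X : Type*} [MeasurableSpace X] [MeasurableSingletonClass X]
    (pts : ℕ → X) (n : ℕ) (f : X → ℝ) :
    ∫ x, f x ∂((n : ℝ≥0∞)⁻¹ • ∑ i ∈ Finset.range n, Measure.dirac (pts i)) =
      (n : ℝ)⁻¹ * ∑ i ∈ Finset.range n, f (pts i) := by
  rw [integral_smul_measure, integral_finsetSum_measure]
  · simp [integral_dirac]
  · intro i _
    exact integrable_dirac (by simp)

/-- An average of values of absolute value at most `e` has absolute value at most `e`. -/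
theorem abs_average_le (n : ℕ) (hn : 1 ≤ n) (g : ℕ → ℝ) (e : ℝ) (hg : ∀ i, |g i| ≤ e) :
    |(n : ℝ)⁻¹ * ∑ i ∈ Finset.range n, g i| ≤ e := by
  have hn0 : (0 : ℝ) < n := by exact_mod_cast hn
  have h : |∑ i ∈ Finset.range n, g i| ≤ n * e := by
    refine (Finset.abs_sum_le_sum_abs _ _).trans ?_
    refine (Finset.sum_le_sum fun i _ => hg i).trans ?_
    simp
  rw [abs_mul, abs_of_pos (inv_pos.2 hn0), inv_mul_le_iff₀ hn0]
  exact h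

/-- A total variation limit of empirical measures is concentrated on the sample points. -/
theorem measure_compl_range_eq_zero {X : Type*} [MeasurableSpace X]
    [MeasurableSingletonClass X] (pts : ℕ → X) (μ : Measure X) [IsFiniteMeasure μ]
    (hTV : ∀ ε > (0 : ℝ), ∃ N : ℕ, ∀ n ≥ N, ∀ f : X → ℝ, Measurable f →
      (∀ x, |f x| ≤ 1) →
        |(n : ℝ)⁻¹ * ∑ i ∈ Finset.range n, f (pts i) - ∫ x, f x ∂μ| ≤ ε) :
    μ (Set.range pts)ᶜ = 0 := by
  have hS : MeasurableSet (Set.range pts)ᶜ := (Set.countable_range pts).measurableSet.compl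
  have hle : μ.real (Set.range pts)ᶜ ≤ 0 := by
    refine le_of_forall_pos_le_add fun ε hε => ?_
    obtain ⟨N, hN⟩ := hTV ε hε
    have h := hN N le_rfl ((Set.range pts)ᶜ.indicator 1) (measurable_one.indicator hS) ?_
    · rw [integral_indicator_one hS] at h
      simp only [Set.mem_compl_iff, Set.mem_range_self, not_true_eq_false, not_false_eq_true,
        Set.indicator_of_notMem, Finset.sum_const_zero, mul_zero, zero_sub, abs_neg] at h
      linarith [le_abs_self (μ.real (Set.range pts)ᶜ)]
    · intro x
      by_cases hx : x ∈ (Set.range pts)ᶜ <;> simp [Set.indicator, hx]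
  exact (measureReal_eq_zero_iff).1 (le_antisymm hle measureReal_nonneg)

/-- Averages over the sample points of an arbitrary bounded function converge to its integral
against the total variation limit of the empirical measures. -/
theorem tendsto_average {X : Type*} [MeasurableSpace X]
    [MeasurableSingletonClass X] (pts : ℕ → X) (μ : Measure X) [IsFiniteMeasure μ]
    (hTV : ∀ ε > (0 : ℝ), ∃ N : ℕ, ∀ n ≥ N, ∀ f : X → ℝ, Measurable f →
      (∀ x, |f x| ≤ 1) →
        |(n : ℝ)⁻¹ * ∑ i ∈ Finset.range n, f (pts i) - ∫ x, f x ∂μ| ≤ ε)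
    (f : X → ℝ) (B : ℝ) (hB : 0 < B) (hf : ∀ x, |f x| ≤ B) :
    Tendsto (fun n : ℕ => (n : ℝ)⁻¹ * ∑ i ∈ Finset.range n, f (pts i)) atTop
      (nhds (∫ x, f x ∂μ)) := by
  have h0 := measure_compl_range_eq_zero pts μ hTV
  have hcount := Set.countable_range pts
  set g : X → ℝ := (Set.range pts).indicator fun x => B⁻¹ * f x with hg
  have hgm : Measurable g := by
    refine (measurable_const (a := (0 : ℝ))).measurable_of_countable_ne ?_
    refine hcount.mono fun x hx => ?_
    by_contra hxS
    exact hx (by simp [hg, Set.indicator_of_notMem hxS])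
  have hg1 : ∀ x, |g x| ≤ 1 := by
    intro x
    by_cases hx : x ∈ Set.range pts
    · rw [hg, Set.indicator_of_mem hx, abs_mul, abs_of_pos (inv_pos.2 hB),
        inv_mul_le_iff₀ hB, mul_one]
      exact hf x
    · rw [hg, Set.indicator_of_notMem hx]
      simp
  have hgp : ∀ i, g (pts i) = B⁻¹ * f (pts i) := fun i => by
    rw [hg, Set.indicator_of_mem (Set.mem_range_self i)]
  have hgi : ∫ x, g x ∂μ = B⁻¹ * ∫ x, f x ∂μ := by
    rw [← integral_const_mul]
    refine integral_congr_ae ?_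
    filter_upwards [mem_ae_iff.2 h0] with x hx
    rw [hg, Set.indicator_of_mem hx]
  have hlim : Tendsto (fun n : ℕ => (n : ℝ)⁻¹ * ∑ i ∈ Finset.range n, g (pts i)) atTop
      (nhds (∫ x, g x ∂μ)) := by
    rw [Metric.tendsto_atTop]
    intro ε hε
    obtain ⟨N, hN⟩ := hTV (ε / 2) (half_pos hε)
    refine ⟨N, fun n hn => ?_⟩
    rw [Real.dist_eq]
    linarith [hN n hn g hgm hg1]
  have hmul := hlim.const_mul B
  rw [hgi, mul_inv_cancel_left₀ hB.ne'] at hmul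
  refine hmul.congr fun n => ?_
  simp only [hgp, ← Finset.mul_sum]
  field_simp

theorem statement15 {X : Type*} [MetricSpace X] [MeasurableSpace X] [BorelSpace X]
    (C : ℝ) (hC : ∀ x y : X, dist x y ≤ C)
    (pts : ℕ → X) (μs : ℕ → Measure X) (μ : Measure X)
    (hμs : ∀ n : ℕ, 1 ≤ n →
      μs n = (n : ℝ≥0∞)⁻¹ • ∑ i ∈ Finset.range n, Measure.dirac (pts i))
    (hprob : ∀ n : ℕ, 1 ≤ n → IsProbabilityMeasure (μs n)) [IsProbabilityMeasure μ]
    (hTV : ∀ ε > (0 : ℝ), ∃ N : ℕ, ∀ n ≥ N, ∀ f : X → ℝ, Measurable f →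
      (∀ x, |f x| ≤ 1) → |(∫ x, f x ∂(μs n)) - ∫ x, f x ∂μ| ≤ ε)
    (c : ℝ)
    (hKbddn : ∀ n : ℕ, 1 ≤ n → ∀ x y : X, |assocKernel (μs n) x y| ≤ c)
    (hKbdd : ∀ x y : X, |assocKernel μ x y| ≤ c)
    (hKunif : TendstoUniformly (fun n (p : X × X) => assocKernel (μs n) p.1 p.2)
      (fun p : X × X => assocKernel μ p.1 p.2) atTop)
    (lamn : ℕ → ℝ) (lam : ℝ) (hlam : Tendsto lamn atTop (nhds lam)) (hlamne : lam ≠ 0)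
    (φn : ℕ → X → ℝ)
    (heig : ∀ n : ℕ, 1 ≤ n → ∀ x : X,
      lamn n * φn n x = ∫ y, assocKernel (μs n) x y * φn n y ∂(μs n))
    (φinf : X → ℝ)
    (hφconv : TendstoUniformly (fun n x => φn n x) φinf atTop)
    (M : ℝ) (hM : ∀ n : ℕ, 1 ≤ n → (∫ y, |φn n y| ∂(μs n)) ≤ M) :
    ∀ x : X, lam * φinf x = ∫ y, assocKernel μ x y * φinf y ∂μ := by
  have hTV' : ∀ ε > (0 : ℝ), ∃ N : ℕ, ∀ n ≥ N, ∀ f : X → ℝ, Measurable f →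
      (∀ x, |f x| ≤ 1) →
        |(n : ℝ)⁻¹ * ∑ i ∈ Finset.range n, f (pts i) - ∫ x, f x ∂μ| ≤ ε := by
    intro ε hε
    obtain ⟨N, hN⟩ := hTV ε hε
    refine ⟨max N 1, fun n hn f hf hf1 => ?_⟩
    have h := hN n (le_of_max_le_left hn) f hf hf1
    rwa [hμs n (le_of_max_le_right hn), integral_empirical] at h
  have heig' : ∀ n : ℕ, 1 ≤ n → ∀ x : X, lamn n * φn n x =
      (n : ℝ)⁻¹ * ∑ i ∈ Finset.range n, assocKernel (μs n) x (pts i) * φn n (pts i) := by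
    intro n hn x
    rw [heig n hn x, ← integral_empirical pts n fun y => assocKernel (μs n) x y * φn n y]
    exact congrArg
      (fun ν => ∫ y, assocKernel (μs n) x y * φn n y ∂ν) (hμs n hn)
  intro x
  have hc : 0 ≤ c := (abs_nonneg _).trans (hKbdd x x)
  rw [Metric.tendstoUniformly_iff] at hKunif
  have hφunif := Metric.tendstoUniformly_iff.1 hφconv
  obtain ⟨B, hB0, hB⟩ : ∃ B : ℝ, 0 < B ∧ ∀ y, |φinf y| ≤ B := by
    obtain ⟨n, hdist, hne, hn⟩ := ((hφunif 1 one_pos).and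
      ((hlam.eventually_ne hlamne).and (eventually_ge_atTop 1))).exists
    set A : ℝ := ∑ i ∈ Finset.range n, c * |φn n (pts i)| with hA
    have hA0 : 0 ≤ A := Finset.sum_nonneg fun i _ => mul_nonneg hc (abs_nonneg _)
    have hn0 : (0 : ℝ) < n := by exact_mod_cast hn
    set D : ℝ := |lamn n|⁻¹ * ((n : ℝ)⁻¹ * A) with hD
    have hD0 : 0 ≤ D := by positivity
    refine ⟨D + 1, by linarith, fun y => ?_⟩
    have hφ : |φn n y| ≤ D := by
      rw [hD, le_inv_mul_iff₀ (abs_pos.2 hne), ← abs_mul, heig' n hn y, abs_mul,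
        abs_of_pos (inv_pos.2 hn0)]
      gcongr
      refine (Finset.abs_sum_le_sum_abs _ _).trans (Finset.sum_le_sum fun i _ => ?_)
      rw [abs_mul]
      gcongr
      exact hKbddn n hn _ _
    have h1 := hdist y
    rw [Real.dist_eq] at h1
    have h2 := abs_sub_abs_le_abs_sub (φinf y) (φn n y)
    linarith
  have hlim := tendsto_average pts μ hTV' (fun y => assocKernel μ x y * φinf y)
    ((c + 1) * B) (by positivity) fun y => by
      rw [abs_mul]
      have := hKbdd x y
      gcongr
      · linarith
      · exact hB y
  have herr : Tendsto (fun n => lamn n * φn n x -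
      (n : ℝ)⁻¹ * ∑ i ∈ Finset.range n, assocKernel μ x (pts i) * φinf (pts i))
      atTop (nhds 0) := by
    rw [Metric.tendsto_nhds]
    intro ε hε
    have hpos : 0 < c + B + 1 := by positivity
    have hδ : 0 < ε / (c + B + 1) := by positivity
    set δ := ε / (c + B + 1) with hδdef
    have hδε : δ * (c + B + 1) = ε := div_mul_cancel₀ _ hpos.ne'
    filter_upwards [hKunif δ hδ, hφunif δ hδ, eventually_ge_atTop 1] with n hK hφ hn
    rw [dist_zero_right, Real.norm_eq_abs, heig' n hn x, ← mul_sub, ← Finset.sum_sub_distrib]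
    refine (abs_average_le n hn _ (c * δ + δ * B) fun i => ?_).trans_lt (by nlinarith)
    have hK' := hK (x, pts i)
    have hφ' := hφ (pts i)
    rw [dist_comm, Real.dist_eq] at hK' hφ'
    have hsplit : assocKernel (μs n) x (pts i) * φn n (pts i) -
        assocKernel μ x (pts i) * φinf (pts i) =
        assocKernel (μs n) x (pts i) * (φn n (pts i) - φinf (pts i)) +
          (assocKernel (μs n) x (pts i) - assocKernel μ x (pts i)) * φinf (pts i) := by ring
    rw [hsplit]
    refine (abs_add_le _ _).trans (add_le_add ?_ ?_)
    · rw [abs_mul]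
      exact mul_le_mul (hKbddn n hn _ _) hφ'.le (abs_nonneg _) hc
    · rw [abs_mul]
      exact mul_le_mul hK'.le (hB _) (abs_nonneg _) hδ.le
  have hleft : Tendsto (fun n => lamn n * φn n x) atTop (nhds (lam * φinf x)) :=
    hlam.mul (hφconv.tendsto_at x)
  have hright := herr.add hlim
  simp only [sub_add_cancel, zero_add] at hright
  exact tendsto_nhds_unique hleft hright
end
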